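/- arXiv:2401.02828 — 11 statements merged into one kernel-verified Lean document; each statement's English description precedes it below -/
import Mathlib

section
/- For every real power parameter λ and all positive reals δ and Y, the power-divergence loss L_{PDL,λ}(δ, Y) is nonnegative, and L_{PDL,λ}(δ, Y) = 0 if and only if δ = Y. -/
/-- The power-divergence loss with power parameter `lam`, defined for `δ > 0`, `Y > 0`. -/
noncomputable def PDL (lam δ Y : ℝ) : ℝ :=
  if lam = 0 then Y * Real.log (Y / δ) - (Y - δ)
  else if lam = -1 then Y - δ - δ * Real.log (Y / δ)
  else (1 / (lam * (lam + 1))) * (Y * ((Y / δ) ^ lam - 1) + lam * (δ - Y))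

/-- Strict Bernoulli inequality for negative exponents. -/
theorem one_add_mul_sub_one_lt_rpow_of_neg {t p : ℝ} (ht : 0 < t) (ht1 : t ≠ 1) (hp : p < 0) :
    1 + p * (t - 1) < t ^ p := by
  have hinv : t⁻¹ - 1 ≠ 0 := sub_ne_zero.mpr (inv_ne_one.mpr ht1)
  have h := one_add_mul_self_lt_rpow_one_add (s := t⁻¹ - 1) (p := 1 - p)
    (by linarith [inv_pos.mpr ht]) hinv (by linarith)
  rw [add_sub_cancel, Real.inv_rpow ht.le, ← Real.rpow_neg ht.le, neg_sub,
    Real.rpow_sub_one ht.ne', lt_div_iff₀ ht] at h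
  have hmul : t⁻¹ * t = 1 := inv_mul_cancel₀ ht.ne'
  linear_combination h - (1 - p) * hmul

/-- The sign of the gap in Bernoulli's inequality is that of `p * (p - 1)`. -/
theorem rpow_bernoulli_gap_div_pos {t p : ℝ} (ht : 0 < t) (ht1 : t ≠ 1) (hp0 : p ≠ 0)
    (hp1 : p ≠ 1) : 0 < (t ^ p - 1 - p * (t - 1)) / (p * (p - 1)) := by
  have hs : -1 ≤ t - 1 := by linarith
  have hs0 : t - 1 ≠ 0 := sub_ne_zero.mpr ht1
  rcases hp0.lt_or_gt with hneg | hpos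
  · have h := one_add_mul_sub_one_lt_rpow_of_neg ht ht1 hneg
    exact div_pos (by linarith) (mul_pos_of_neg_of_neg hneg (by linarith))
  rcases hp1.lt_or_gt with hlt | hgt
  · have h := rpow_one_add_lt_one_add_mul_self hs hs0 hpos hlt
    rw [add_sub_cancel] at h
    exact div_pos_of_neg_of_neg (by linarith) (mul_neg_of_pos_of_neg hpos (by linarith))
  · have h := one_add_mul_self_lt_rpow_one_add hs hs0 hgt
    rw [add_sub_cancel] at h
    exact div_pos (by linarith) (mul_pos hpos (by linarith))

theorem PDL_self (lam : ℝ) {δ : ℝ} (hδ : 0 < δ) : PDL lam δ δ = 0 := by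
  simp [PDL, hδ.ne']

theorem PDL_pos (lam : ℝ) {δ Y : ℝ} (hδ : 0 < δ) (hY : 0 < Y) (hne : δ ≠ Y) :
    0 < PDL lam δ Y := by
  obtain ⟨t, rfl⟩ : ∃ t, Y = δ * t := ⟨Y / δ, (mul_div_cancel₀ Y hδ.ne').symm⟩
  have ht : 0 < t := pos_of_mul_pos_right hY hδ.le
  have ht1 : t ≠ 1 := by rintro rfl; simp at hne
  unfold PDL
  rw [mul_div_cancel_left₀ t hδ.ne']
  split_ifs with h0 h1
  · have h := Real.log_lt_sub_one_of_pos (inv_pos.mpr ht) (inv_ne_one.mpr ht1)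
    rw [Real.log_inv] at h
    have hmul : t * t⁻¹ = 1 := mul_inv_cancel₀ ht.ne'
    have h2 := mul_lt_mul_of_pos_left h (mul_pos hδ ht)
    linear_combination h2 + δ * hmul
  · have h2 := mul_lt_mul_of_pos_left (Real.log_lt_sub_one_of_pos ht ht1) hδ
    linear_combination h2
  · have hlam : lam + 1 ≠ 0 := fun h => h1 (by linarith)
    have hgap := mul_pos hδ
      (rpow_bernoulli_gap_div_pos ht ht1 hlam (fun h => h0 (by linarith)))
    rw [Real.rpow_add_one ht.ne', add_sub_cancel_right] at hgap
    refine hgap.trans_eq ?_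
    field_simp
    ring

/-- For every real power parameter `lam` and all positive reals `δ` and `Y`, the
power-divergence loss is nonnegative, and it is zero if and only if `δ = Y`. -/
theorem PDL_nonneg_and_eq_zero_iff (lam δ Y : ℝ) (hδ : 0 < δ) (hY : 0 < Y) :
    0 ≤ PDL lam δ Y ∧ (PDL lam δ Y = 0 ↔ δ = Y) := by
  rcases eq_or_ne δ Y with rfl | hne
  · simp [PDL_self lam hδ]
  · have h := PDL_pos lam hδ hY hne
    exact ⟨h.le, iff_of_false h.ne' hne⟩
end

section
/- For every real power parameter λ, the power-divergence loss L_{PDL,λ}(δ, Y) is a jointly convex function of the pair (δ, Y) on the open quadrant {(δ, Y) : δ > 0, Y > 0}. -/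
/-- The perspective `(x, y) ↦ x * f (y / x)` of a convex function on the positive half-line is
jointly convex on the open quadrant. -/
theorem ConvexOn.perspective_Ioi {f : ℝ → ℝ} (hf : ConvexOn ℝ (Set.Ioi 0) f) :
    ConvexOn ℝ (Set.Ioi (0 : ℝ) ×ˢ Set.Ioi (0 : ℝ)) (fun p : ℝ × ℝ => p.1 * f (p.2 / p.1)) := by
  refine ⟨(convex_Ioi 0).prod (convex_Ioi 0), ?_⟩
  rintro ⟨x₁, y₁⟩ ⟨hx₁ : 0 < x₁, hy₁ : 0 < y₁⟩ ⟨x₂, y₂⟩ ⟨hx₂ : 0 < x₂, hy₂ : 0 < y₂⟩ a b ha hb hab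
  simp only [Prod.smul_mk, Prod.mk_add_mk, smul_eq_mul]
  have hx : 0 < a * x₁ + b * x₂ := (convex_Ioi (0 : ℝ)) hx₁ hx₂ ha hb hab
  have key := hf.2 (Set.mem_Ioi.2 (div_pos hy₁ hx₁)) (Set.mem_Ioi.2 (div_pos hy₂ hx₂))
    (show 0 ≤ a * x₁ / (a * x₁ + b * x₂) by positivity)
    (show 0 ≤ b * x₂ / (a * x₁ + b * x₂) by positivity) (by field_simp)
  simp only [smul_eq_mul] at key
  have harg : a * x₁ / (a * x₁ + b * x₂) * (y₁ / x₁) + b * x₂ / (a * x₁ + b * x₂) * (y₂ / x₂)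
      = (a * y₁ + b * y₂) / (a * x₁ + b * x₂) := by field_simp
  rw [harg] at key
  refine (mul_le_mul_of_nonneg_left key hx.le).trans_eq ?_
  field_simp

theorem PDL_eq_mul_PDL_one (lam : ℝ) {δ : ℝ} (hδ : δ ≠ 0) (Y : ℝ) :
    PDL lam δ Y = δ * PDL lam 1 (Y / δ) := by
  unfold PDL
  split_ifs
  · simp only [div_one]
    field_simp
  · simp only [div_one]
    field_simp
  · simp only [div_one]
    generalize (Y / δ) ^ lam = z
    generalize 1 / (lam * (lam + 1)) = c
    field_simp

theorem hasDerivAt_PDL_one {lam u : ℝ} (hu : 0 < u) :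
    HasDerivAt (PDL lam 1) (if lam = 0 then Real.log u else (u ^ lam - 1) / lam) u := by
  have hlog := Real.hasDerivAt_log hu.ne'
  have hid := hasDerivAt_id' u
  unfold PDL
  simp only [div_one]
  by_cases h0 : lam = 0
  · simp only [h0, if_true]
    refine ((hid.mul hlog).sub (hid.sub_const 1)).congr_deriv ?_
    field_simp
    ring
  by_cases h1 : lam = -1
  · simp only [h1, if_true, one_mul]
    norm_num
    refine ((hid.sub_const 1).sub hlog).congr_deriv ?_
    rw [Real.rpow_neg_one]
    ring
  · simp only [h0, h1, if_false]
    have h1' : lam + 1 ≠ 0 := fun h => h1 (by linarith)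
    have hpow := Real.hasDerivAt_rpow_const (p := lam) (Or.inl hu.ne')
    refine (((hid.mul (hpow.sub_const 1)).add
      ((hid.const_sub 1).const_mul lam)).const_mul _).congr_deriv ?_
    rw [Real.rpow_sub_one hu.ne']
    field_simp
    ring

theorem convexOn_PDL_one (lam : ℝ) : ConvexOn ℝ (Set.Ioi 0) (PDL lam 1) := by
  refine MonotoneOn.convexOn_of_deriv (convex_Ioi 0)
    (fun u hu => (hasDerivAt_PDL_one hu).continuousAt.continuousWithinAt) ?_ ?_ <;>
    rw [interior_Ioi]
  · exact fun u hu => (hasDerivAt_PDL_one hu).differentiableAt.differentiableWithinAt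
  intro u (hu : 0 < u) v (hv : 0 < v) huv
  rw [(hasDerivAt_PDL_one hu).deriv, (hasDerivAt_PDL_one hv).deriv]
  split_ifs with h0
  · exact Real.log_le_log hu huv
  rcases lt_or_gt_of_ne h0 with h | h
  · exact div_le_div_of_nonpos_of_le h.le
      (sub_le_sub_right (Real.rpow_le_rpow_of_nonpos hu huv h.le) 1)
  · have := Real.rpow_le_rpow hu.le huv h.le
    gcongr

/-- For every real power parameter `lam`, the power-divergence loss is jointly convex
as a function of the pair `(δ, Y)` on the open quadrant `{(δ, Y) : δ > 0, Y > 0}`. -/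
theorem PDL_convexOn (lam : ℝ) :
    ConvexOn ℝ (Set.Ioi (0 : ℝ) ×ˢ Set.Ioi (0 : ℝ))
      (fun p : ℝ × ℝ => PDL lam p.1 p.2) := by
  exact (convexOn_PDL_one lam).perspective_Ioi.congr fun p hp =>
    (PDL_eq_mul_PDL_one lam (ne_of_gt hp.1) p.2).symm
end

section
/- For every f ∈ (0, 1), the asymmetry measure of power-divergence loss satisfies A_{PDL,−2}(f) = (1−f)^2 and A_{PDL,−1/2}(f) = 1 − f; that is, PDL with λ = −2 has the same asymmetry measure as squared-error loss (whose asymmetry measure is (1−f)^2) and PDL with λ = −1/2 has the same asymmetry measure as absolute-error loss (whose asymmetry measure is 1 − f). -/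
/-- Squared-error loss. -/
def SEL (δ Y : ℝ) : ℝ := (δ - Y) ^ 2

/-- Absolute-error loss. -/
def AEL (δ Y : ℝ) : ℝ := |δ - Y|

/-- For `lam = -2`, power-divergence loss is squared error weighted by `1 / (2 * Y)`. -/
theorem PDL_neg_two {δ Y : ℝ} (hδ : 0 < δ) (hY : 0 < Y) :
    PDL (-2) δ Y = (δ - Y) ^ 2 / (2 * Y) := by
  have hpow : (Y / δ) ^ (-2 : ℝ) = (δ / Y) ^ 2 := by
    rw [Real.rpow_neg (by positivity), Real.rpow_two, ← inv_pow, inv_div]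
  rw [PDL, if_neg (by norm_num), if_neg (by norm_num), hpow]
  field_simp
  ring

/-- For `lam = -1/2`, power-divergence loss is twice the squared error of the square roots. -/
theorem PDL_neg_half {δ Y : ℝ} (hδ : 0 < δ) (hY : 0 < Y) :
    PDL (-(1/2)) δ Y = 2 * (√δ - √Y) ^ 2 := by
  have hpow : (Y / δ) ^ (-(1/2) : ℝ) = √δ / √Y := by
    rw [Real.rpow_neg (by positivity), ← Real.sqrt_eq_rpow, Real.sqrt_div hY.le, inv_div]
  rw [PDL, if_neg (by norm_num), if_neg (by norm_num), hpow]
  have hsY : 0 < √Y := Real.sqrt_pos.2 hY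
  have hY2 : Y * (√δ / √Y - 1) = √Y * √δ - Y := by
    field_simp
    linear_combination (-√δ) * Real.sq_sqrt hY.le
  rw [hY2]
  linear_combination (-2) * Real.sq_sqrt hδ.le - 2 * Real.sq_sqrt hY.le

/-- For every `f ∈ (0, 1)` (and any `Y > 0`), the asymmetry measure of power-divergence
loss satisfies `A_{PDL,−2}(f) = (1−f)²` and `A_{PDL,−1/2}(f) = 1−f`; that is, PDL with
`λ = −2` has the same asymmetry measure as squared-error loss (whose asymmetry measure is
`(1−f)²`) and PDL with `λ = −1/2` has the same asymmetry measure as absolute-error loss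
(whose asymmetry measure is `1 − f`). -/
theorem APDL_neg_two_and_neg_half (f Y : ℝ) (hf : f ∈ Set.Ioo (0 : ℝ) 1) (hY : 0 < Y) :
    PDL (-2) ((1 - f) * Y) Y / PDL (-2) ((1 - f)⁻¹ * Y) Y = (1 - f) ^ 2 ∧
    SEL ((1 - f) * Y) Y / SEL ((1 - f)⁻¹ * Y) Y = (1 - f) ^ 2 ∧
    PDL (-(1/2)) ((1 - f) * Y) Y / PDL (-(1/2)) ((1 - f)⁻¹ * Y) Y = 1 - f ∧
    AEL ((1 - f) * Y) Y / AEL ((1 - f)⁻¹ * Y) Y = 1 - f := by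
  have hf0 := hf.1
  have hf1 := hf.2
  obtain ⟨c, hc⟩ : ∃ c, c = 1 - f := ⟨_, rfl⟩
  rw [← hc]
  have hc0 : 0 < c := by linarith
  have hc1 : 1 - c ≠ 0 := by linarith
  have hinv : c⁻¹ * Y - Y = c⁻¹ * (1 - c) * Y := by field_simp
  have hmul : c * Y - Y = -((1 - c) * Y) := by ring
  refine ⟨?_, ?_, ?_, ?_⟩
  · rw [PDL_neg_two (by positivity) hY, PDL_neg_two (by positivity) hY, hinv, hmul]
    field_simp
  · rw [SEL, SEL, hinv, hmul]
    field_simp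
  · rw [PDL_neg_half (by positivity) hY, PDL_neg_half (by positivity) hY,
      Real.sqrt_mul hc0.le, Real.sqrt_mul (by positivity), Real.sqrt_inv]
    have hsc : 0 < √c := Real.sqrt_pos.2 hc0
    have hsY : 0 < √Y := Real.sqrt_pos.2 hY
    have hs1 : 1 - √c ≠ 0 := by
      rw [sub_ne_zero, ne_comm, Ne, Real.sqrt_eq_one]
      linarith
    have hsinv : (√c)⁻¹ * √Y - √Y = (√c)⁻¹ * (1 - √c) * √Y := by field_simp
    have hsmul : √c * √Y - √Y = -((1 - √c) * √Y) := by ring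
    rw [hsinv, hsmul]
    field_simp
    exact Real.sq_sqrt hc0.le
  · rw [AEL, AEL, hinv, hmul, abs_neg, mul_assoc, abs_mul c⁻¹, abs_of_pos (inv_pos.2 hc0)]
    have habs : |(1 - c) * Y| ≠ 0 := by positivity
    field_simp
end

section
/- For every real power parameter λ, the asymmetry measure of power-divergence loss satisfies lim_{f → 0⁺} A_{PDL,λ}(f) = 1. -/
/-- The divergence-generating function `φ⁺_λ`, defined for `x > 0`. -/
noncomputable def phiPlus (lam x : ℝ) : ℝ :=
  if lam = 0 then x * Real.log x - x + 1
  else if lam = -1 then -Real.log x + x - 1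
  else (1 / (lam * (lam + 1))) * (x ^ (lam + 1) - x + lam * (1 - x))

/-- The asymmetry measure of power-divergence loss with power parameter `lam`,
`A_{PDL,λ}(f) = (1−f)² · φ⁺_λ((1−f)⁻¹) / φ⁺_λ(1−f)` for `f ∈ (0, 1)`. -/
noncomputable def APDL (lam f : ℝ) : ℝ :=
  (1 - f) ^ 2 * phiPlus lam ((1 - f)⁻¹) / phiPlus lam (1 - f)

/-- The derivative of `phiPlus lam` on `(0, ∞)`. -/
noncomputable def phiPlusDeriv (lam x : ℝ) : ℝ :=
  if lam = 0 then Real.log x else (x ^ lam - 1) / lam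

theorem hasDerivAt_phiPlus (lam : ℝ) {x : ℝ} (hx : 0 < x) :
    HasDerivAt (phiPlus lam) (phiPlusDeriv lam x) x := by
  unfold phiPlus phiPlusDeriv
  by_cases h0 : lam = 0
  · simp only [h0, if_true]
    refine ((((hasDerivAt_id x).mul (Real.hasDerivAt_log hx.ne')).sub
      (hasDerivAt_id x)).add_const 1).congr_deriv ?_
    simp [hx.ne']
  · by_cases h1 : lam = -1
    · simp only [h1, if_true, show (-1 : ℝ) ≠ 0 by norm_num, if_false, Real.rpow_neg_one]
      refine (((Real.hasDerivAt_log hx.ne').neg.add (hasDerivAt_id x)).sub_const 1).congr_deriv ?_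
      ring
    · simp only [h0, h1, if_false]
      have h2 : lam + 1 ≠ 0 := fun h => h1 (by linarith)
      refine ((((Real.hasDerivAt_rpow_const (p := lam + 1) (Or.inl hx.ne')).sub
        (hasDerivAt_id x)).add (((hasDerivAt_id x).const_sub 1).const_mul lam)).const_mul
        (1 / (lam * (lam + 1)))).congr_deriv ?_
      rw [add_sub_cancel_right]
      field_simp
      ring

theorem phiPlus_one (lam : ℝ) : phiPlus lam 1 = 0 := by
  simp [phiPlus]

theorem phiPlusDeriv_one (lam : ℝ) : phiPlusDeriv lam 1 = 0 := by
  simp [phiPlusDeriv]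

theorem hasDerivAt_phiPlusDeriv_one (lam : ℝ) : HasDerivAt (phiPlusDeriv lam) 1 1 := by
  unfold phiPlusDeriv
  by_cases h0 : lam = 0
  · simp only [h0, if_true]
    simpa using Real.hasDerivAt_log one_ne_zero
  · simp only [h0, if_false]
    refine (((Real.hasDerivAt_rpow_const (p := lam) (Or.inl one_ne_zero)).sub_const 1).div_const
      lam).congr_deriv ?_
    simp [h0]

open Filter Topology in
theorem tendsto_phiPlus_div_sq (lam : ℝ) :
    Tendsto (fun x => phiPlus lam x / (x - 1) ^ 2) (𝓝[≠] 1) (𝓝 (1 / 2)) := by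
  refine HasDerivAt.lhopital_zero_nhdsNE (f' := phiPlusDeriv lam) (g' := fun x => 2 * (x - 1))
    ?_ ?_ ?_ ?_ ?_ ?_
  · exact eventually_nhdsWithin_of_eventually_nhds
      ((lt_mem_nhds one_pos).mono fun x hx => hasDerivAt_phiPlus lam hx)
  · refine Eventually.of_forall fun x => ?_
    exact (((hasDerivAt_id x).sub_const 1).pow 2).congr_deriv (by simp)
  · filter_upwards [self_mem_nhdsWithin] with x hx
    exact mul_ne_zero two_ne_zero (sub_ne_zero.mpr hx)
  · have h := (hasDerivAt_phiPlus lam one_pos).continuousAt.tendsto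
    rw [phiPlus_one] at h
    exact h.mono_left nhdsWithin_le_nhds
  · have h : Continuous fun x : ℝ => (x - 1) ^ 2 := by fun_prop
    simpa using (h.tendsto 1).mono_left nhdsWithin_le_nhds
  · refine ((hasDerivAt_iff_tendsto_slope.mp (hasDerivAt_phiPlusDeriv_one lam)).div_const
      2).congr fun x => ?_
    rw [slope_def_field, phiPlusDeriv_one, sub_zero, div_div, mul_comm]

/-- For every real power parameter `lam`, `lim_{f → 0⁺} A_{PDL,λ}(f) = 1`. -/
theorem APDL_tendsto_one_at_zero (lam : ℝ) :
    Filter.Tendsto (APDL lam) (nhdsWithin 0 (Set.Ioo (0 : ℝ) 1)) (nhds 1) := by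
  have hx : Filter.Tendsto (fun f : ℝ => 1 - f) (nhdsWithin 0 (Set.Ioo (0 : ℝ) 1))
      (nhdsWithin 1 {1}ᶜ) := by
    refine tendsto_nhdsWithin_iff.mpr ⟨?_, ?_⟩
    · have h : Continuous fun f : ℝ => 1 - f := by fun_prop
      simpa using (h.tendsto 0).mono_left nhdsWithin_le_nhds
    · filter_upwards [self_mem_nhdsWithin] with f hf
      simpa using hf.1.ne'
  have hy : Filter.Tendsto (fun f : ℝ => (1 - f)⁻¹) (nhdsWithin 0 (Set.Ioo (0 : ℝ) 1))
      (nhdsWithin 1 {1}ᶜ) := by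
    refine tendsto_nhdsWithin_iff.mpr ⟨?_, ?_⟩
    · simpa using (tendsto_nhdsWithin_iff.mp hx).1.inv₀ one_ne_zero
    · filter_upwards [self_mem_nhdsWithin] with f hf
      simpa using hf.1.ne'
  have h := ((tendsto_phiPlus_div_sq lam).comp hy).div ((tendsto_phiPlus_div_sq lam).comp hx)
    (by norm_num)
  rw [div_self (by norm_num)] at h
  refine h.congr' ?_
  filter_upwards [self_mem_nhdsWithin] with f hf
  have hf0 : f ≠ 0 := hf.1.ne'
  have hf1 : 1 - f ≠ 0 := (sub_pos.mpr hf.2).ne'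
  have e1 : (1 - f)⁻¹ - 1 = f / (1 - f) := by
    field_simp
    ring
  have e2 : 1 - f - 1 = -f := by ring
  simp only [Pi.div_apply, Function.comp_apply, APDL, e1, e2, neg_sq]
  field_simp
end

section
/- The asymmetry measure of power-divergence loss satisfies: lim_{f → 1⁻} A_{PDL,λ}(f) = 0 if λ < 1; lim_{f → 1⁻} A_{PDL,λ}(f) = 1 if λ = 1; and A_{PDL,λ}(f) → ∞ as f → 1⁻ if λ > 1. -/
open Filter Topology

theorem tendsto_rpow_nhdsGT_zero {s : ℝ} (hs : 0 < s) :
    Tendsto (fun x : ℝ => x ^ s) (𝓝[>] 0) (𝓝 0) := by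
  have h := (Real.continuousAt_rpow_const 0 s (Or.inr hs.le)).tendsto
  rw [Real.zero_rpow hs.ne'] at h
  exact h.mono_left nhdsWithin_le_nhds

theorem tendsto_nhdsGT_zero_of_continuous {g : ℝ → ℝ} (hg : Continuous g) {c : ℝ}
    (hc : g 0 = c) : Tendsto g (𝓝[>] 0) (𝓝 c) :=
  hc ▸ hg.continuousAt.tendsto.mono_left nhdsWithin_le_nhds

theorem tendsto_phiPlus_nhdsGT_zero {lam : ℝ} (h : -1 < lam) :
    Tendsto (phiPlus lam) (𝓝[>] 0) (𝓝 (1 / (lam + 1))) := by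
  rcases eq_or_ne lam 0 with rfl | h0
  · refine (tendsto_nhdsGT_zero_of_continuous
      (g := fun x => x * Real.log x - x + 1) ?_ (by simp)).congr fun x => by simp [phiPlus]
    exact (Real.continuous_mul_log.sub continuous_id).add continuous_const
  · have h1 : lam + 1 ≠ 0 := by linarith
    refine (tendsto_nhdsGT_zero_of_continuous
      (g := fun x => (1 / (lam * (lam + 1))) * (x ^ (lam + 1) - x + lam * (1 - x))) ?_ ?_).congr
        fun x => by simp [phiPlus, h0, h.ne']
    · have := Real.continuous_rpow_const (q := lam + 1) (by linarith)
      fun_prop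
    · simp only [Real.zero_rpow h1]
      field_simp
      ring

theorem tendsto_phiPlus_nhdsGT_zero_atTop {lam : ℝ} (h : lam ≤ -1) :
    Tendsto (phiPlus lam) (𝓝[>] 0) atTop := by
  rcases h.eq_or_lt with rfl | h
  · refine (Tendsto.atTop_add (tendsto_neg_atBot_atTop.comp Real.tendsto_log_nhdsGT_zero)
      (tendsto_nhdsGT_zero_of_continuous (g := fun x => x - 1) (by fun_prop) rfl)).congr
        fun x => by simp [phiPlus]; ring
  · have h0 : lam ≠ 0 := by linarith
    have hc : 0 < 1 / (lam * (lam + 1)) :=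
      one_div_pos.2 (mul_pos_of_neg_of_neg (by linarith) (by linarith))
    refine (((tendsto_rpow_neg_nhdsGT_zero (y := lam + 1) (by linarith)).atTop_add
      (tendsto_nhdsGT_zero_of_continuous (g := fun x => -x + lam * (1 - x))
        (by fun_prop) rfl)).const_mul_atTop hc).congr fun x => ?_
    simp only [phiPlus, h0, h.ne, if_false]
    ring

theorem sq_mul_phiPlus_inv {lam x : ℝ} (h0 : lam ≠ 0) (h1 : lam ≠ -1) (hx : 0 < x) :
    x ^ 2 * phiPlus lam x⁻¹ =
      (1 / (lam * (lam + 1))) * (x ^ (1 - lam) + (-x + lam * (x ^ 2 - x))) := by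
  have hp : x ^ 2 * x⁻¹ ^ (lam + 1) = x ^ (1 - lam) := by
    rw [Real.inv_rpow hx.le, ← Real.rpow_neg hx.le, ← Real.rpow_natCast, ← Real.rpow_add hx]
    congr 1
    push_cast
    ring
  have hx2 : x ^ 2 * x⁻¹ = x := by field_simp
  simp only [phiPlus, h0, h1, if_false]
  linear_combination (1 / (lam * (lam + 1))) * (hp - (1 + lam) * hx2)

theorem tendsto_sq_mul_phiPlus_inv_zero {lam : ℝ} (h : lam < 1) :
    Tendsto (fun x => x ^ 2 * phiPlus lam x⁻¹) (𝓝[>] 0) (𝓝 0) := by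
  rcases eq_or_ne lam 0 with rfl | h0
  · refine (tendsto_nhdsGT_zero_of_continuous
      (g := fun x => -(x * Real.log x) - x + x ^ 2) ?_ (by simp)).congr' ?_
    · exact (Real.continuous_mul_log.neg.sub continuous_id).add (by fun_prop)
    · filter_upwards [self_mem_nhdsWithin] with x hx
      have hx : x ≠ 0 := ne_of_gt hx
      simp only [phiPlus, if_true, Real.log_inv]
      field_simp
  rcases eq_or_ne lam (-1) with rfl | h1
  · refine (tendsto_nhdsGT_zero_of_continuous
      (g := fun x => x * (x * Real.log x) + x - x ^ 2) ?_ (by simp)).congr' ?_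
    · exact ((continuous_id.mul Real.continuous_mul_log).add continuous_id).sub (by fun_prop)
    · filter_upwards [self_mem_nhdsWithin] with x hx
      have hx : x ≠ 0 := ne_of_gt hx
      simp only [phiPlus, h0, if_true, if_false, Real.log_inv]
      field_simp
  · have hl := ((tendsto_rpow_nhdsGT_zero (sub_pos.2 h)).add
      (tendsto_nhdsGT_zero_of_continuous (g := fun x => -x + lam * (x ^ 2 - x)) (c := 0)
        (by fun_prop) (by simp))).const_mul (1 / (lam * (lam + 1)))
    rw [add_zero, mul_zero] at hl
    refine hl.congr' ?_
    filter_upwards [self_mem_nhdsWithin] with x hx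
    exact (sq_mul_phiPlus_inv h0 h1 hx).symm

theorem tendsto_sq_mul_phiPlus_one_inv :
    Tendsto (fun x => x ^ 2 * phiPlus 1 x⁻¹) (𝓝[>] 0) (𝓝 (1 / 2)) := by
  refine (tendsto_nhdsGT_zero_of_continuous
    (g := fun x => (1 / 2) * (1 + (-x + (x ^ 2 - x)))) (by fun_prop) (by norm_num)).congr' ?_
  filter_upwards [self_mem_nhdsWithin] with x hx
  rw [sq_mul_phiPlus_inv one_ne_zero (by norm_num) hx]
  norm_num

theorem tendsto_sq_mul_phiPlus_inv_atTop {lam : ℝ} (h : 1 < lam) :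
    Tendsto (fun x => x ^ 2 * phiPlus lam x⁻¹) (𝓝[>] 0) atTop := by
  have hc : 0 < 1 / (lam * (lam + 1)) := by positivity
  refine (((tendsto_rpow_neg_nhdsGT_zero (sub_neg.2 h)).atTop_add
    (tendsto_nhdsGT_zero_of_continuous (g := fun x => -x + lam * (x ^ 2 - x))
      (by fun_prop) rfl)).const_mul_atTop hc).congr' ?_
  filter_upwards [self_mem_nhdsWithin] with x hx
  exact (sq_mul_phiPlus_inv (by linarith) (by linarith) hx).symm

theorem tendsto_one_sub_nhdsGT_zero :
    Tendsto (fun f : ℝ => 1 - f) (𝓝[Set.Ioo 0 1] 1) (𝓝[>] 0) := by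
  refine tendsto_nhdsWithin_iff.2 ⟨?_, ?_⟩
  · have h : Continuous fun f : ℝ => 1 - f := by fun_prop
    simpa using (h.tendsto 1).mono_left nhdsWithin_le_nhds
  · filter_upwards [self_mem_nhdsWithin] with f hf
    exact sub_pos.2 hf.2

/-- As `f → 1⁻`, the asymmetry measure `A_{PDL,λ}(f)` tends to `0` if `λ < 1`,
to `1` if `λ = 1`, and to `∞` if `λ > 1`. -/
theorem APDL_limits_at_one (lam : ℝ) :
    (lam < 1 →
      Filter.Tendsto (APDL lam) (nhdsWithin 1 (Set.Ioo (0 : ℝ) 1)) (nhds 0)) ∧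
    (lam = 1 →
      Filter.Tendsto (APDL lam) (nhdsWithin 1 (Set.Ioo (0 : ℝ) 1)) (nhds 1)) ∧
    (1 < lam →
      Filter.Tendsto (APDL lam) (nhdsWithin 1 (Set.Ioo (0 : ℝ) 1)) Filter.atTop) := by
  refine ⟨fun h => ?_, ?_, fun h => ?_⟩
  · refine Tendsto.comp (g := fun x => x ^ 2 * phiPlus lam x⁻¹ / phiPlus lam x) ?_
      tendsto_one_sub_nhdsGT_zero
    rcases le_or_gt lam (-1) with h1 | h1
    · exact (tendsto_sq_mul_phiPlus_inv_zero h).div_atTop (tendsto_phiPlus_nhdsGT_zero_atTop h1)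
    · have hd : 1 / (lam + 1) ≠ 0 := one_div_ne_zero (by linarith)
      have hl := (tendsto_sq_mul_phiPlus_inv_zero h).div (tendsto_phiPlus_nhdsGT_zero h1) hd
      rwa [zero_div] at hl
  · rintro rfl
    refine Tendsto.comp (g := fun x => x ^ 2 * phiPlus 1 x⁻¹ / phiPlus 1 x) ?_
      tendsto_one_sub_nhdsGT_zero
    have hl := tendsto_sq_mul_phiPlus_one_inv.div
      (tendsto_phiPlus_nhdsGT_zero (lam := 1) (by norm_num)) (by norm_num)
    norm_num at hl
    exact hl
  · refine Tendsto.comp (g := fun x => x ^ 2 * phiPlus lam x⁻¹ / phiPlus lam x) ?_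
      tendsto_one_sub_nhdsGT_zero
    have hd : 0 < 1 / (lam + 1) := by positivity
    exact (tendsto_sq_mul_phiPlus_inv_atTop h).atTop_mul_pos (inv_pos.2 hd)
      ((tendsto_phiPlus_nhdsGT_zero (by linarith)).inv₀ hd.ne')
end

section
/- For every f ∈ (0, 1), the asymmetry measure of power-divergence loss satisfies A_{PDL,λ}(f) < 1 whenever λ < 1, and A_{PDL,λ}(f) > 1 whenever λ > 1; that is, for λ < 1 an f×100% multiplicative over-prediction incurs strictly greater loss than the corresponding under-prediction, and conversely for λ > 1. -/
/-- The derivative of `phiPlus lam`, i.e. the Box–Cox transform. -/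
noncomputable def boxCox (lam t : ℝ) : ℝ :=
  if lam = 0 then Real.log t else (t ^ lam - 1) / lam

theorem hasDerivAt_phiPlus_s8 (lam : ℝ) {t : ℝ} (ht : 0 < t) :
    HasDerivAt (phiPlus lam) (boxCox lam t) t := by
  have hid := hasDerivAt_id' t
  by_cases h0 : lam = 0
  · have h : phiPlus lam = fun x => x * Real.log x - x + 1 := by
      funext x; simp [phiPlus, h0]
    rw [h]
    refine (((hid.mul (Real.hasDerivAt_log ht.ne')).sub hid).add_const 1).congr_deriv ?_
    simp [boxCox, h0, ht.ne']
  by_cases h1 : lam = -1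
  · have h : phiPlus lam = fun x => -Real.log x + x - 1 := by
      funext x; simp [phiPlus, h1]
    rw [h]
    refine (((Real.hasDerivAt_log ht.ne').neg.add hid).sub_const 1).congr_deriv ?_
    simp only [boxCox, if_neg h0]
    rw [h1, Real.rpow_neg_one]
    ring
  · have h : phiPlus lam =
        fun x => (1 / (lam * (lam + 1))) * (x ^ (lam + 1) - x + lam * (1 - x)) := by
      funext x; simp [phiPlus, h0, h1]
    have h1' : lam + 1 ≠ 0 := fun h => h1 (by linarith)
    rw [h]
    refine ((((Real.hasDerivAt_rpow_const (p := lam + 1) (Or.inl ht.ne')).sub hid).add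
      ((hid.const_sub 1).const_mul lam)).const_mul (1 / (lam * (lam + 1)))).congr_deriv ?_
    simp only [boxCox, h0, if_false, add_sub_cancel_right]
    field_simp
    ring

theorem sub_one_lt_boxCox {lam t : ℝ} (hl : 1 < lam) (ht : 0 < t) (ht1 : t ≠ 1) :
    t - 1 < boxCox lam t := by
  have h := one_add_mul_self_lt_rpow_one_add (s := t - 1) (by linarith) (sub_ne_zero.2 ht1) hl
  rw [add_sub_cancel] at h
  rw [boxCox, if_neg (by linarith), lt_div_iff₀ (by linarith)]
  linarith

theorem boxCox_lt_sub_one {lam t : ℝ} (hl : lam < 1) (ht : 0 < t) (ht1 : t ≠ 1) :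
    boxCox lam t < t - 1 := by
  unfold boxCox
  rcases lt_trichotomy lam 0 with h0 | h0 | h0
  · have hlog := Real.log_lt_sub_one_of_pos ht ht1
    have hexp := Real.add_one_le_exp (Real.log t * lam)
    rw [← Real.rpow_def_of_pos ht] at hexp
    rw [if_neg h0.ne, div_lt_iff_of_neg h0]
    nlinarith
  · rw [if_pos h0]
    exact Real.log_lt_sub_one_of_pos ht ht1
  · have h := rpow_one_add_lt_one_add_mul_self (s := t - 1) (by linarith)
      (sub_ne_zero.2 ht1) h0 hl
    rw [add_sub_cancel] at h
    rw [if_neg h0.ne', div_lt_iff₀ h0]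
    linarith

/-- A function vanishing at `1` whose derivative on `(0, ∞)` is positive away from `1`
changes sign from negative to positive at `1`. -/
theorem neg_and_pos_of_hasDerivAt_pos {g g' : ℝ → ℝ} (hg : ∀ t, 0 < t → HasDerivAt g (g' t) t)
    (hg' : ∀ t, 0 < t → t ≠ 1 → 0 < g' t) (h1 : g 1 = 0) :
    (∀ x, 0 < x → x < 1 → g x < 0) ∧ ∀ y, 1 < y → 0 < g y := by
  have key : ∀ a b, 0 < a → a < b → (b ≤ 1 ∨ 1 ≤ a) → g a < g b := by
    intro a b ha hab h
    obtain ⟨c, ⟨hac, hcb⟩, hc⟩ := exists_hasDerivAt_eq_slope g g' hab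
      (fun t ht => (hg t (ha.trans_le ht.1)).continuousAt.continuousWithinAt)
      (fun t ht => hg t (ha.trans ht.1))
    have hc1 : c ≠ 1 := by
      rcases h with h | h
      · exact (hcb.trans_le h).ne
      · exact (h.trans_lt hac).ne'
    have hpos := hg' c (ha.trans hac) hc1
    rw [hc, div_pos_iff_of_pos_right (sub_pos.2 hab)] at hpos
    linarith
  exact ⟨fun x hx hx1 => h1 ▸ key x 1 hx hx1 (Or.inl le_rfl),
    fun y hy => h1 ▸ key 1 y one_pos hy (Or.inr le_rfl)⟩

theorem hasDerivAt_phiPlus_sub_sq (lam : ℝ) {t : ℝ} (ht : 0 < t) :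
    HasDerivAt (fun x => phiPlus lam x - (x - 1) ^ 2 / 2) (boxCox lam t - (t - 1)) t := by
  refine ((hasDerivAt_phiPlus_s8 lam ht).sub
    ((((hasDerivAt_id' t).sub_const 1).pow 2).div_const 2)).congr_deriv ?_
  simp

theorem phiPlus_pos_of_one_lt {lam x : ℝ} (hl : 1 < lam) (hx : 0 < x) (hx1 : x ≠ 1) :
    0 < phiPlus lam x := by
  have h := one_add_mul_self_lt_rpow_one_add (s := x - 1) (p := lam + 1) (by linarith)
    (sub_ne_zero.2 hx1) (by linarith)
  rw [add_sub_cancel] at h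
  rw [phiPlus, if_neg (by linarith), if_neg (by linarith)]
  exact mul_pos (by positivity) (by linarith)

theorem sq_mul_inv_sub_one_sq {x : ℝ} (hx : x ≠ 0) :
    x ^ 2 * ((x⁻¹ - 1) ^ 2 / 2) = (x - 1) ^ 2 / 2 := by
  field_simp
  ring

/-- For every `f ∈ (0, 1)`, `A_{PDL,λ}(f) < 1` whenever `λ < 1` (over-prediction incurs
strictly greater loss than the corresponding under-prediction), and `A_{PDL,λ}(f) > 1`
whenever `λ > 1`. -/
theorem APDL_lt_one_of_lam_lt_one (lam f : ℝ) (hf : f ∈ Set.Ioo (0 : ℝ) 1) :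
    (lam < 1 → APDL lam f < 1) ∧ (1 < lam → 1 < APDL lam f) := by
  have hx : 0 < 1 - f := sub_pos.2 hf.2
  have hx1 : 1 - f < 1 := by linarith [hf.1]
  unfold APDL
  generalize 1 - f = x at hx hx1
  have hinv : 1 < x⁻¹ := (one_lt_inv₀ hx).2 hx1
  have hsq := sq_mul_inv_sub_one_sq hx.ne'
  have hx2 : 0 < x ^ 2 := by positivity
  constructor
  · intro hl
    obtain ⟨hlow, hup⟩ := neg_and_pos_of_hasDerivAt_pos
      (fun t ht => (hasDerivAt_phiPlus_sub_sq lam ht).neg)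
      (fun t ht ht1 => by linarith [boxCox_lt_sub_one hl ht ht1])
      (by simp [phiPlus_one])
    have hx_lt : (x - 1) ^ 2 / 2 < phiPlus lam x := by
      simpa using hlow x hx hx1
    have hinv_lt : phiPlus lam x⁻¹ < (x⁻¹ - 1) ^ 2 / 2 := by
      simpa using hup x⁻¹ hinv
    rw [div_lt_one (lt_of_le_of_lt (by positivity) hx_lt)]
    linarith [mul_lt_mul_of_pos_left hinv_lt hx2]
  · intro hl
    obtain ⟨hlow, hup⟩ := neg_and_pos_of_hasDerivAt_pos
      (fun t ht => hasDerivAt_phiPlus_sub_sq lam ht)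
      (fun t ht ht1 => sub_pos.2 (sub_one_lt_boxCox hl ht ht1))
      (by simp [phiPlus_one])
    rw [one_lt_div (phiPlus_pos_of_one_lt hl hx hx1.ne)]
    linarith [mul_lt_mul_of_pos_left (sub_pos.1 (hup x⁻¹ hinv)) hx2, hlow x hx hx1]
end

section
/- Let Y be a strictly positive random variable with E(Y) < ∞ and E(|log Y|) < ∞. Then the function δ ↦ E[L_{PDL,−1}(δ, Y)] on (0, ∞) attains its minimum at the unique point δ* = exp(E(log Y)). -/
open MeasureTheory

/-- The expected power-divergence loss with power parameter `-1`, in closed form. -/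
theorem integral_PDL_neg_one {Ω : Type*} [MeasurableSpace Ω] {μ : Measure Ω}
    [IsProbabilityMeasure μ] {Y : Ω → ℝ} (hYpos : ∀ ω, 0 < Y ω) (hYint : Integrable Y μ)
    (hYlog : Integrable (fun ω => Real.log (Y ω)) μ) {δ : ℝ} (hδ : 0 < δ) :
    ∫ ω, PDL (-1) δ (Y ω) ∂μ =
      ∫ ω, Y ω ∂μ - δ - δ * (∫ ω, Real.log (Y ω) ∂μ - Real.log δ) := by
  have hPDL : ∀ ω, PDL (-1) δ (Y ω) = Y ω - δ - δ * (Real.log (Y ω) - Real.log δ) := by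
    intro ω
    simp [PDL, Real.log_div (hYpos ω).ne' hδ.ne']
  have hYδ : Integrable (fun ω => Y ω - δ) μ := hYint.sub (integrable_const δ)
  have hlogδ : Integrable (fun ω => Real.log (Y ω) - Real.log δ) μ :=
    hYlog.sub (integrable_const _)
  simp_rw [hPDL]
  rw [integral_sub hYδ (hlogδ.const_mul δ), integral_sub hYint (integrable_const δ),
    integral_const_mul, integral_sub hYlog (integrable_const _)]
  simp

/-- Away from the exponential of the mean of `log Y`, the expected power-divergence loss with
power parameter `-1` is strictly larger than at that point. -/
theorem integral_PDL_neg_one_exp_lt {Ω : Type*} [MeasurableSpace Ω] {μ : Measure Ω}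
    [IsProbabilityMeasure μ] {Y : Ω → ℝ} (hYpos : ∀ ω, 0 < Y ω) (hYint : Integrable Y μ)
    (hYlog : Integrable (fun ω => Real.log (Y ω)) μ) {δ : ℝ} (hδ : 0 < δ)
    (hne : δ ≠ Real.exp (∫ ω, Real.log (Y ω) ∂μ)) :
    ∫ ω, PDL (-1) (Real.exp (∫ ω', Real.log (Y ω') ∂μ)) (Y ω) ∂μ <
      ∫ ω, PDL (-1) δ (Y ω) ∂μ := by
  rw [integral_PDL_neg_one hYpos hYint hYlog hδ,
    integral_PDL_neg_one hYpos hYint hYlog (Real.exp_pos _), Real.log_exp]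
  set m := ∫ ω, Real.log (Y ω) ∂μ
  have hx : m - Real.log δ ≠ 0 := by
    intro h
    apply hne
    rw [sub_eq_zero.mp h, Real.exp_log hδ]
  have hexp : Real.exp m = δ * Real.exp (m - Real.log δ) := by
    rw [Real.exp_sub, Real.exp_log hδ, mul_div_cancel₀ _ hδ.ne']
  have hlt := mul_lt_mul_of_pos_left (Real.add_one_lt_exp hx) hδ
  rw [← hexp] at hlt
  linarith

/-- Let `Y` be a strictly positive random variable with `E(Y) < ∞` and `E(|log Y|) < ∞`.
Then `δ ↦ E[L_{PDL,−1}(δ, Y)]` on `(0, ∞)` attains its minimum at the unique point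
`δ* = exp(E(log Y))`. -/
theorem expected_PDL_neg_one_min {Ω : Type*} [MeasureSpace Ω]
    [IsProbabilityMeasure (volume : Measure Ω)]
    (Y : Ω → ℝ) (hYmeas : Measurable Y) (hYpos : ∀ ω, 0 < Y ω)
    (hYint : Integrable Y) (hYlog : Integrable (fun ω => Real.log (Y ω))) :
    IsMinOn (fun δ => ∫ ω, PDL (-1) δ (Y ω)) (Set.Ioi (0 : ℝ))
      (Real.exp (∫ ω, Real.log (Y ω))) ∧
    ∀ δ ∈ Set.Ioi (0 : ℝ), δ ≠ Real.exp (∫ ω, Real.log (Y ω)) →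
      (∫ ω, PDL (-1) (Real.exp (∫ ω', Real.log (Y ω'))) (Y ω)) <
        ∫ ω, PDL (-1) δ (Y ω) := by
  refine ⟨fun δ hδ => ?_, fun δ hδ hne => integral_PDL_neg_one_exp_lt hYpos hYint hYlog hδ hne⟩
  by_cases hne : δ = Real.exp (∫ ω, Real.log (Y ω))
  · simp [hne]
  · exact (integral_PDL_neg_one_exp_lt hYpos hYint hYlog hδ hne).le
end

section
/- Let Y be a strictly positive random variable and for λ ∈ ℝ define the optimal power-divergence (OPD) predictor δ*_λ = (E(Y^{λ+1}))^{1/(λ+1)} for λ ≠ −1 and δ*_{−1} = exp(E(log Y)), assuming the corresponding expectations are finite. Then δ*_λ ≥ E(Y) when λ > 0, δ*_0 = E(Y), and δ*_λ ≤ E(Y) when λ < 0 (covering all three cases λ ∈ (−1, 0), λ = −1, and λ < −1); that is, the OPD predictor is positively biased for λ > 0, unbiased for λ = 0, and negatively biased for λ < 0. -/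
open MeasureTheory

section PowerMeans

variable {Ω : Type*} [MeasurableSpace Ω] {μ : Measure Ω} [IsProbabilityMeasure μ] {Y : Ω → ℝ}

lemma integral_pos_of_forall_pos (hpos : ∀ ω, 0 < Y ω) (hint : Integrable Y μ) :
    0 < ∫ ω, Y ω ∂μ := by
  rw [integral_pos_iff_support_of_nonneg (fun ω => (hpos ω).le) hint,
    Function.support_eq_univ fun ω => (hpos ω).ne']
  simp

lemma rpow_integral_le_integral_rpow_of_one_le {p : ℝ} (hp : 1 ≤ p) (hpos : ∀ ω, 0 < Y ω)
    (hint : Integrable Y μ) (hpint : Integrable (fun ω => Y ω ^ p) μ) :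
    (∫ ω, Y ω ∂μ) ^ p ≤ ∫ ω, Y ω ^ p ∂μ :=
  (convexOn_rpow hp).map_integral_le
    (Real.continuous_rpow_const (by linarith)).continuousOn isClosed_Ici
    (.of_forall fun ω => (hpos ω).le) hint hpint

lemma integral_rpow_le_rpow_integral {p : ℝ} (hp₀ : 0 ≤ p) (hp₁ : p ≤ 1) (hpos : ∀ ω, 0 < Y ω)
    (hint : Integrable Y μ) (hpint : Integrable (fun ω => Y ω ^ p) μ) :
    ∫ ω, Y ω ^ p ∂μ ≤ (∫ ω, Y ω ∂μ) ^ p :=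
  (Real.concaveOn_rpow hp₀ hp₁).le_map_integral
    (Real.continuous_rpow_const hp₀).continuousOn isClosed_Ici
    (.of_forall fun ω => (hpos ω).le) hint hpint

/-- Bernoulli's inequality for nonpositive exponents. -/
lemma one_add_mul_sub_one_le_rpow_of_nonpos {p x : ℝ} (hp : p ≤ 0) (hx : 0 < x) :
    1 + p * (x - 1) ≤ x ^ p := by
  rw [Real.rpow_def_of_pos hx]
  nlinarith [Real.add_one_le_exp (Real.log x * p), Real.log_le_sub_one_of_pos hx]

lemma rpow_integral_le_integral_rpow_of_nonpos {p : ℝ} (hp : p ≤ 0) (hpos : ∀ ω, 0 < Y ω)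
    (hint : Integrable Y μ) (hpint : Integrable (fun ω => Y ω ^ p) μ) :
    (∫ ω, Y ω ∂μ) ^ p ≤ ∫ ω, Y ω ^ p ∂μ := by
  set m := ∫ ω, Y ω ∂μ with hm_def
  have hm : 0 < m := integral_pos_of_forall_pos hpos hint
  have tangent (ω : Ω) : m ^ p * (1 + p * (Y ω / m - 1)) ≤ Y ω ^ p := by
    have h := one_add_mul_sub_one_le_rpow_of_nonpos hp (div_pos (hpos ω) hm)
    rwa [Real.div_rpow (hpos ω).le hm.le, le_div_iff₀' (Real.rpow_pos_of_pos hm p)] at h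
  have hsub : Integrable (fun ω => Y ω / m - 1) μ := (hint.div_const m).sub (integrable_const 1)
  have hlin : Integrable (fun ω => p * (Y ω / m - 1)) μ := hsub.const_mul p
  calc m ^ p = ∫ ω, m ^ p * (1 + p * (Y ω / m - 1)) ∂μ := by
        rw [integral_const_mul, integral_add (integrable_const 1) hlin, integral_const_mul,
          integral_sub (hint.div_const m) (integrable_const 1), integral_div, ← hm_def,
          div_self hm.ne']
        simp
    _ ≤ ∫ ω, Y ω ^ p ∂μ :=
        integral_mono (((integrable_const 1).add hlin).const_mul _) hpint tangent

end PowerMeans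

/-- Let `Y` be a strictly positive random variable with `E(Y) < ∞`, and for `λ ∈ ℝ` let
the optimal power-divergence predictor be `δ*_λ = (E(Y^{λ+1}))^{1/(λ+1)}` for `λ ≠ −1`
and `δ*_{−1} = exp(E(log Y))`, assuming the corresponding expectations are finite.
Then `δ*_λ ≥ E(Y)` when `λ > 0`, `δ*_0 = E(Y)`, and `δ*_λ ≤ E(Y)` when `λ < 0`
(covering all three cases `λ ∈ (−1, 0)`, `λ = −1`, and `λ < −1`). -/
theorem OPD_bias_sign {Ω : Type*} [MeasureSpace Ω]
    [IsProbabilityMeasure (volume : Measure Ω)]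
    (Y : Ω → ℝ) (hYmeas : Measurable Y) (hYpos : ∀ ω, 0 < Y ω)
    (hYint : Integrable Y) :
    (∀ lam : ℝ, 0 < lam → Integrable (fun ω => Y ω ^ (lam + 1)) →
      (∫ ω, Y ω) ≤ (∫ ω, Y ω ^ (lam + 1)) ^ (1 / (lam + 1))) ∧
    ((∫ ω, Y ω ^ ((0 : ℝ) + 1)) ^ (1 / ((0 : ℝ) + 1)) = ∫ ω, Y ω) ∧
    (∀ lam : ℝ, lam < 0 → lam ≠ -1 → Integrable (fun ω => Y ω ^ (lam + 1)) →
      (∫ ω, Y ω ^ (lam + 1)) ^ (1 / (lam + 1)) ≤ ∫ ω, Y ω) ∧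
    (Integrable (fun ω => Real.log (Y ω)) →
      Real.exp (∫ ω, Real.log (Y ω)) ≤ ∫ ω, Y ω) := by
  have hm := integral_pos_of_forall_pos hYpos hYint
  refine ⟨fun lam hlam hint => ?_, by simp, fun lam hlam hne hint => ?_, fun hlog => ?_⟩
  · rw [one_div, Real.le_rpow_inv_iff_of_pos hm.le
      (integral_nonneg fun ω => Real.rpow_nonneg (hYpos ω).le _) (by linarith)]
    exact rpow_integral_le_integral_rpow_of_one_le (by linarith) hYpos hYint hint
  · have hpow := integral_pos_of_forall_pos (fun ω => Real.rpow_pos_of_pos (hYpos ω) _) hint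
    rw [one_div]
    rcases lt_or_gt_of_ne hne with h | h
    · rw [Real.rpow_inv_le_iff_of_neg hpow hm (by linarith)]
      exact rpow_integral_le_integral_rpow_of_nonpos (by linarith) hYpos hYint hint
    · rw [Real.rpow_inv_le_iff_of_pos hpow.le hm.le (by linarith)]
      exact integral_rpow_le_rpow_integral (by linarith) (by linarith) hYpos hYint hint
  · have hexp : Real.exp ∘ (fun ω => Real.log (Y ω)) = Y :=
      funext fun ω => Real.exp_log (hYpos ω)
    have h := convexOn_exp.map_integral_le Real.continuous_exp.continuousOn isClosed_univ
      (.of_forall fun _ => Set.mem_univ _) hlog (hexp.symm ▸ hYint)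
    simpa only [Real.exp_log (hYpos _)] using h
end

section
/- Let λ ∈ ℝ with λ ≠ 0, and let Y be a strictly positive random variable with E(Y) < ∞ and, if λ ≠ −1, E(Y^{λ+1}) < ∞, and if λ = −1, E(|log Y|) < ∞. Let δ*_λ denote the optimal power-divergence predictor ((E(Y^{λ+1}))^{1/(λ+1)} for λ ≠ −1, exp(E(log Y)) for λ = −1). Then the minimised expected power-divergence loss satisfies E[L_{PDL,λ}(δ*_λ, Y)] = (δ*_λ − E(Y))/λ, and this quantity is nonnegative. -/
open MeasureTheory

/-- The optimal power-divergence (OPD) predictor of a strictly positive random variable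
`Y`: `δ*_λ = (E(Y^{λ+1}))^{1/(λ+1)}` for `λ ≠ −1` and `δ*_{−1} = exp(E(log Y))`. -/
noncomputable def OPD {Ω : Type*} [MeasureSpace Ω] (Y : Ω → ℝ) (lam : ℝ) : ℝ :=
  if lam = -1 then Real.exp (∫ ω, Real.log (Y ω))
  else (∫ ω, Y ω ^ (lam + 1)) ^ (1 / (lam + 1))

theorem one_add_mul_sub_one_le_rpow_of_neg {p x : ℝ} (hp : p < 0) (hx : 0 < x) :
    1 + p * (x - 1) ≤ x ^ p := by
  have h := one_add_mul_self_le_rpow_one_add (s := x⁻¹ - 1) (p := 1 - p)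
    (by have := inv_pos.2 hx; linarith) (by linarith)
  rw [add_sub_cancel] at h
  have h2 := mul_le_mul_of_nonneg_left h hx.le
  have e : x * x⁻¹ ^ (1 - p) = x ^ p := by
    rw [Real.inv_rpow hx.le, ← Real.rpow_neg hx.le, neg_sub, Real.rpow_sub_one hx.ne']
    field_simp
  rw [e] at h2
  have e2 : x * (1 + (1 - p) * (x⁻¹ - 1)) = 1 + p * (x - 1) := by
    field_simp
    ring
  linarith

theorem PDL_eq_of_ne {lam δ Y : ℝ} (h0 : lam ≠ 0) (h1 : lam ≠ -1) (hY : 0 < Y) (hδ : 0 < δ) :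
    PDL lam δ Y =
      (1 / (lam * (lam + 1))) * (δ ^ (-lam) * Y ^ (lam + 1) - Y + lam * (δ - Y)) := by
  rw [PDL, if_neg h0, if_neg h1, Real.div_rpow hY.le hδ.le, Real.rpow_neg hδ.le,
    Real.rpow_add_one hY.ne']
  ring

theorem PDL_nonneg {lam δ Y : ℝ} (h0 : lam ≠ 0) (hY : 0 < Y) (hδ : 0 < δ) :
    0 ≤ PDL lam δ Y := by
  have hx : 0 < Y / δ := div_pos hY hδ
  by_cases h1 : lam = -1
  · rw [PDL, if_neg h0, if_pos h1]
    have h := mul_le_mul_of_nonneg_left (Real.log_le_sub_one_of_pos hx) hδ.le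
    rw [mul_sub, mul_div_cancel₀ _ hδ.ne'] at h
    linarith
  have h1' : lam + 1 ≠ 0 := fun h => h1 (by linarith)
  have key : PDL lam δ Y =
      δ * (((Y / δ) ^ (lam + 1) - (1 + (lam + 1) * (Y / δ - 1))) / (lam * (lam + 1))) := by
    rw [PDL, if_neg h0, if_neg h1, Real.rpow_add_one hx.ne']
    field_simp
    ring
  rw [key]
  refine mul_nonneg hδ.le ?_
  have hs : -1 ≤ Y / δ - 1 := by linarith
  rcases lt_or_gt_of_ne h0 with hneg | hpos
  · rcases lt_or_gt_of_ne h1' with hneg' | hpos'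
    · have h := one_add_mul_sub_one_le_rpow_of_neg hneg' hx
      exact div_nonneg (by linarith) (mul_nonneg_of_nonpos_of_nonpos hneg.le hneg'.le)
    · have h := rpow_one_add_le_one_add_mul_self hs hpos'.le (by linarith)
      rw [add_sub_cancel] at h
      exact div_nonneg_of_nonpos (by linarith) (mul_nonpos_of_nonpos_of_nonneg hneg.le hpos'.le)
  · have h := one_add_mul_self_le_rpow_one_add hs (p := lam + 1) (by linarith)
    rw [add_sub_cancel] at h
    exact div_nonneg (by linarith) (by positivity)

theorem integral_pos_of_forall_pos_s14 {Ω : Type*} [MeasurableSpace Ω] {μ : Measure Ω}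
    [NeZero μ] {f : Ω → ℝ} (hf : Integrable f μ) (hpos : ∀ ω, 0 < f ω) :
    0 < ∫ ω, f ω ∂μ := by
  rw [integral_pos_iff_support_of_nonneg (fun ω => (hpos ω).le) hf,
    Function.support_eq_univ (fun ω => (hpos ω).ne')]
  exact Measure.measure_univ_pos.2 (NeZero.ne μ)

/-- For `λ ≠ 0`, the minimised expected power-divergence loss satisfies
`E[L_{PDL,λ}(δ*_λ, Y)] = (δ*_λ − E(Y))/λ`, and this quantity is nonnegative. -/
theorem minimised_expected_PDL {Ω : Type*} [MeasureSpace Ω]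
    [IsProbabilityMeasure (volume : Measure Ω)]
    (lam : ℝ) (hlam : lam ≠ 0)
    (Y : Ω → ℝ) (hYmeas : Measurable Y) (hYpos : ∀ ω, 0 < Y ω)
    (hYint : Integrable Y)
    (hpow : lam ≠ -1 → Integrable (fun ω => Y ω ^ (lam + 1)))
    (hlog : lam = -1 → Integrable (fun ω => Real.log (Y ω))) :
    (∫ ω, PDL lam (OPD Y lam) (Y ω)) = (OPD Y lam - ∫ ω, Y ω) / lam ∧
    0 ≤ (OPD Y lam - ∫ ω, Y ω) / lam := by
  have hδ : 0 < OPD Y lam := by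
    rw [OPD]
    split_ifs with h1
    · exact Real.exp_pos _
    · exact Real.rpow_pos_of_pos
        (integral_pos_of_forall_pos_s14 (hpow h1) fun ω => Real.rpow_pos_of_pos (hYpos ω) _) _
  have heq : (∫ ω, PDL lam (OPD Y lam) (Y ω)) = (OPD Y lam - ∫ ω, Y ω) / lam := by
    by_cases h1 : lam = -1
    · have hE : Real.log (OPD Y lam) = ∫ ω, Real.log (Y ω) := by
        rw [OPD, if_pos h1, Real.log_exp]
      generalize OPD Y lam = δ at hδ hE
      have hP : ∀ ω, PDL lam δ (Y ω) = Y ω - δ - δ * (Real.log (Y ω) - Real.log δ) := fun ω => by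
        rw [PDL, if_neg hlam, if_pos h1, Real.log_div (hYpos ω).ne' hδ.ne']
      have hL := hlog h1
      simp_rw [hP]
      have hYδ : Integrable fun ω => Y ω - δ := hYint.sub (integrable_const _)
      have hLδ : Integrable fun ω => Real.log (Y ω) - Real.log δ := hL.sub (integrable_const _)
      rw [integral_sub hYδ (hLδ.const_mul _),
        integral_sub hYint (integrable_const _), integral_const_mul,
        integral_sub hL (integrable_const _), hE, h1]
      simp [div_neg]
    · have h1' : lam + 1 ≠ 0 := fun h => h1 (by linarith)
      have hI := hpow h1
      have hE : (∫ ω, Y ω ^ (lam + 1)) = OPD Y lam ^ (lam + 1) := by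
        rw [OPD, if_neg h1, ← Real.rpow_mul
          (integral_nonneg fun ω => (Real.rpow_pos_of_pos (hYpos ω) _).le),
          one_div_mul_cancel h1', Real.rpow_one]
      generalize OPD Y lam = δ at hδ hE
      simp_rw [fun ω => PDL_eq_of_ne hlam h1 (hYpos ω) hδ]
      have hIY : Integrable fun ω => δ ^ (-lam) * Y ω ^ (lam + 1) - Y ω :=
        (hI.const_mul _).sub hYint
      have hδY : Integrable fun ω => δ - Y ω := (integrable_const _).sub hYint
      rw [integral_const_mul, integral_add hIY (hδY.const_mul _),
        integral_sub (hI.const_mul _) hYint, integral_const_mul, integral_const_mul,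
        integral_sub (integrable_const _) hYint, hE, ← Real.rpow_add hδ, neg_add_cancel_left,
        Real.rpow_one]
      simp only [integral_const, probReal_univ, one_smul]
      field_simp
      ring
  exact ⟨heq, heq ▸ integral_nonneg fun ω => PDL_nonneg hlam (hYpos ω) hδ⟩
end

section
/- Let W be a Gaussian random variable with mean μ ∈ ℝ and variance σ² > 0, let Y = exp(W), and fix q ∈ (0, 1). Set λ*_q = 2·Φ^{−1}(q)/σ − 1, where Φ^{−1} is the quantile function of the standard Gaussian distribution. Then the optimal power-divergence predictor with power λ*_q equals the q-th quantile of the distribution of Y: exp(μ + (λ*_q + 1)σ²/2) = exp(μ + σ·Φ^{−1}(q)), and P(Y ≤ exp(μ + σ·Φ^{−1}(q))) = q. -/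
open MeasureTheory ProbabilityTheory

/-- A Gaussian law with standard deviation `σ` is the image of the standard one under
`x ↦ μ + σ * x`. -/
theorem gaussianReal_eq_map_standard (μ σ : ℝ) :
    gaussianReal μ (⟨σ ^ 2, sq_nonneg σ⟩ : NNReal) =
      (gaussianReal 0 1).map (fun x ↦ μ + σ * x) := by
  have hcomp : (fun x ↦ μ + σ * x) = (μ + ·) ∘ (σ * ·) := rfl
  rw [hcomp, ← Measure.map_map (by fun_prop) (by fun_prop), gaussianReal_map_const_mul,
    gaussianReal_map_const_add]
  simp only [mul_zero, zero_add, mul_one]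
  rfl

/-- The distribution function of a Gaussian law in terms of the standard one. -/
theorem gaussianReal_Iic_add_mul (μ : ℝ) {σ : ℝ} (hσ : 0 < σ) (z : ℝ) :
    gaussianReal μ (⟨σ ^ 2, sq_nonneg σ⟩ : NNReal) (Set.Iic (μ + σ * z)) =
      gaussianReal 0 1 (Set.Iic z) := by
  rw [gaussianReal_eq_map_standard, Measure.map_apply (by fun_prop) measurableSet_Iic]
  congr 1
  ext x
  simp [hσ]

/-- Let `W` be Gaussian with mean `μ` and variance `σ² > 0`, let `Y = exp(W)`, and fix
`q ∈ (0, 1)`. Let `z = Φ⁻¹(q)` be the standard-Gaussian quantile of order `q`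
(characterised by `Φ(z) = q`), and set `λ*_q = 2z/σ − 1`. Then the optimal
power-divergence predictor with power `λ*_q` equals the `q`-th quantile of the
distribution of `Y`: `exp(μ + (λ*_q + 1)σ²/2) = exp(μ + σz)` and
`P(Y ≤ exp(μ + σz)) = q`. -/
theorem lognormal_OPD_calibrated {Ω : Type*} [MeasureSpace Ω]
    [IsProbabilityMeasure (volume : Measure Ω)]
    (μ σ : ℝ) (hσ : 0 < σ) (W : Ω → ℝ) (hW : Measurable W)
    (hmap : Measure.map W volume = gaussianReal μ (⟨σ ^ 2, sq_nonneg σ⟩ : NNReal))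
    (q z : ℝ) (hq : q ∈ Set.Ioo (0 : ℝ) 1)
    (hz : gaussianReal 0 1 (Set.Iic z) = ENNReal.ofReal q) :
    Real.exp (μ + ((2 * z / σ - 1) + 1) * σ ^ 2 / 2) = Real.exp (μ + σ * z) ∧
    volume {ω | Real.exp (W ω) ≤ Real.exp (μ + σ * z)} = ENNReal.ofReal q := by
  refine ⟨?_, ?_⟩
  · congr 1
    field_simp
    ring
  · have hpre : {ω | Real.exp (W ω) ≤ Real.exp (μ + σ * z)} = W ⁻¹' Set.Iic (μ + σ * z) := by
      ext ω
      simp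
    rw [hpre, ← Measure.map_apply hW measurableSet_Iic, hmap, gaussianReal_Iic_add_mul μ hσ, hz]
end

section
/- For every real power parameter λ, every δ > 0, and every K > 0, the equation L_{PDL,λ}(δ, y) = K has exactly one solution y in the open interval (δ, ∞). Equivalently, for λ ≠ 0, −1 the function p_{λ+1}(y) = y^{λ+1} − (λ+1)δ^λ·y − λδ^λ·((λ+1)K − δ) has exactly one root in (δ, ∞); for λ = 0 the function y·log(y/δ) − (y − δ) − K has exactly one root in (δ, ∞); and for λ = −1 the function y − δ − δ·log(y/δ) − K has exactly one root in (δ, ∞). -/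
/-- A function vanishing at `a` whose derivative vanishes at `a` and is strictly increasing on
`[a, ∞)` takes every positive value exactly once on `(a, ∞)`. -/
theorem existsUnique_eq_of_strictMonoOn_deriv {f g : ℝ → ℝ} {a K : ℝ} (hK : 0 < K)
    (hf : ∀ y, a ≤ y → HasDerivAt f (g y) y) (hg : StrictMonoOn g (Set.Ici a))
    (hga : g a = 0) (hfa : f a = 0) : ∃! y : ℝ, y ∈ Set.Ioi a ∧ f y = K := by
  have hcont : ContinuousOn f (Set.Ici a) := fun y hy =>
    (hf y hy).continuousAt.continuousWithinAt
  have hpos : ∀ y, a < y → 0 < g y := fun y hy => by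
    simpa [hga] using hg Set.self_mem_Ici hy.le hy
  have hmono : StrictMonoOn f (Set.Ici a) := by
    refine strictMonoOn_of_deriv_pos (convex_Ici a) hcont fun y hy => ?_
    rw [interior_Ici] at hy
    rw [(hf y (le_of_lt hy)).deriv]
    exact hpos y hy
  have hb : a < a + 1 := by linarith
  have hgb := hpos _ hb
  have hfb : 0 < f (a + 1) := by
    simpa [hfa] using hmono Set.self_mem_Ici hb.le hb
  have hq : 0 < K / g (a + 1) := div_pos hK hgb
  obtain ⟨z, hz, hKz⟩ : ∃ z, a < z ∧ K < f z := by
    refine ⟨a + 1 + K / g (a + 1), by linarith, ?_⟩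
    obtain ⟨c, hc, hslope⟩ := exists_hasDerivAt_eq_slope f g
      (show a + 1 < a + 1 + K / g (a + 1) by linarith)
      (hcont.mono fun y hy => le_trans hb.le hy.1)
      (fun y hy => hf y (le_trans hb.le hy.1.le))
    have hgc : g (a + 1) < g c := hg hb.le (le_trans hb.le hc.1.le) hc.1
    rw [add_sub_cancel_left, eq_div_iff hq.ne'] at hslope
    have h := mul_lt_mul_of_pos_right hgc hq
    rw [mul_div_cancel₀ _ hgb.ne'] at h
    linarith
  obtain ⟨y, hy, hyK⟩ := intermediate_value_Ioo hz.le
    (hcont.mono fun y hy => hy.1) ⟨hfa.trans_lt hK, hKz⟩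
  refine ⟨y, ⟨hy.1, hyK⟩, fun x hx => ?_⟩
  exact hmono.injOn (Set.Ioi_subset_Ici_self hx.1) hy.1.le (hx.2.trans hyK.symm)

theorem existsUnique_PDL_zero {δ K : ℝ} (hδ : 0 < δ) (hK : 0 < K) :
    ∃! y : ℝ, y ∈ Set.Ioi δ ∧ y * Real.log (y / δ) - (y - δ) = K := by
  refine existsUnique_eq_of_strictMonoOn_deriv (g := fun y => Real.log (y / δ)) hK
    (fun y hy => ?_) (fun x hx y hy hxy => ?_) (by simp [hδ.ne']) (by simp [hδ.ne'])
  · have hy0 : 0 < y := hδ.trans_le hy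
    have h := ((hasDerivAt_id y).mul (((hasDerivAt_id y).div_const δ).log
      (div_pos hy0 hδ).ne')).sub ((hasDerivAt_id y).sub_const δ)
    refine h.congr_deriv ?_
    simp only [id]
    field_simp
    ring
  · exact Real.log_lt_log (div_pos (hδ.trans_le hx) hδ) (div_lt_div_of_pos_right hxy hδ)

theorem existsUnique_PDL_neg_one {δ K : ℝ} (hδ : 0 < δ) (hK : 0 < K) :
    ∃! y : ℝ, y ∈ Set.Ioi δ ∧ y - δ - δ * Real.log (y / δ) = K := by
  refine existsUnique_eq_of_strictMonoOn_deriv (g := fun y => 1 - δ / y) hK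
    (fun y hy => ?_) (fun x hx y hy hxy => ?_) (by simp [hδ.ne']) (by simp [hδ.ne'])
  · have hy0 : 0 < y := hδ.trans_le hy
    have h := ((hasDerivAt_id y).sub_const δ).sub ((((hasDerivAt_id y).div_const δ).log
      (div_pos hy0 hδ).ne').const_mul δ)
    refine h.congr_deriv ?_
    simp only [id]
    field_simp
  · exact sub_lt_sub_left (div_lt_div_of_pos_left hδ (hδ.trans_le hx) hxy) 1

theorem existsUnique_PDL_generic {lam δ K : ℝ} (h0 : lam ≠ 0) (h1 : lam ≠ -1)
    (hδ : 0 < δ) (hK : 0 < K) :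
    ∃! y : ℝ, y ∈ Set.Ioi δ ∧
      (1 / (lam * (lam + 1))) * (y * ((y / δ) ^ lam - 1) + lam * (δ - y)) = K := by
  have h1' : lam + 1 ≠ 0 := fun h => h1 (by linarith)
  refine existsUnique_eq_of_strictMonoOn_deriv (g := fun y => ((y / δ) ^ lam - 1) / lam) hK
    (fun y hy => ?_) (fun x hx y hy hxy => ?_) (by simp [hδ.ne']) (by simp [hδ.ne'])
  · have hy0 : 0 < y := hδ.trans_le hy
    have hyδ : 0 < y / δ := div_pos hy0 hδ
    have h := ((((hasDerivAt_id y).mul ((((hasDerivAt_id y).div_const δ).rpow_const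
      (p := lam) (Or.inl hyδ.ne')).sub_const 1)).add
      (((hasDerivAt_id y).const_sub δ).const_mul lam)).const_mul (1 / (lam * (lam + 1))))
    refine h.congr_deriv ?_
    simp only [id]
    rw [Real.rpow_sub_one hyδ.ne']
    field_simp
    ring
  · have hx0 : 0 < x / δ := div_pos (hδ.trans_le hx) hδ
    have hlt : x / δ < y / δ := div_lt_div_of_pos_right hxy hδ
    rcases lt_or_gt_of_ne h0 with hneg | hpos
    · exact div_lt_div_of_neg_of_lt hneg
        (sub_lt_sub_right (Real.rpow_lt_rpow_of_neg hx0 hlt hneg) 1)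
    · exact div_lt_div_of_pos_right
        (sub_lt_sub_right (Real.rpow_lt_rpow hx0.le hlt hpos) 1) hpos

theorem rpow_polynomial_eq_mul_PDL_sub {lam δ K y : ℝ} (h0 : lam ≠ 0) (h1 : lam ≠ -1)
    (hδ : 0 < δ) (hy : 0 < y) :
    y ^ (lam + 1) - (lam + 1) * δ ^ lam * y - lam * δ ^ lam * ((lam + 1) * K - δ) =
      lam * (lam + 1) * δ ^ lam *
        ((1 / (lam * (lam + 1))) * (y * ((y / δ) ^ lam - 1) + lam * (δ - y)) - K) := by
  have h1' : lam + 1 ≠ 0 := fun h => h1 (by linarith)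
  have hδl : δ ^ lam ≠ 0 := (Real.rpow_pos_of_pos hδ lam).ne'
  rw [Real.rpow_add_one hy.ne', Real.div_rpow hy.le hδ.le]
  field_simp
  ring

/-- For every real power parameter `lam`, every `δ > 0`, and every cut-off `K > 0`,
the equation `L_{PDL,λ}(δ, y) = K` has exactly one solution `y ∈ (δ, ∞)`.
Equivalently: for `λ ≠ 0, −1` the function
`p_{λ+1}(y) = y^{λ+1} − (λ+1)δ^λ·y − λδ^λ·((λ+1)K − δ)` has exactly one root in
`(δ, ∞)`; for `λ = 0` the function `y·log(y/δ) − (y − δ) − K` has exactly one root in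
`(δ, ∞)`; and for `λ = −1` the function `y − δ − δ·log(y/δ) − K` has exactly one root
in `(δ, ∞)`. -/
theorem PDL_unique_root_above (lam δ K : ℝ) (hδ : 0 < δ) (hK : 0 < K) :
    (∃! y : ℝ, y ∈ Set.Ioi δ ∧ PDL lam δ y = K) ∧
    (lam ≠ 0 → lam ≠ -1 → ∃! y : ℝ, y ∈ Set.Ioi δ ∧
      y ^ (lam + 1) - (lam + 1) * δ ^ lam * y
        - lam * δ ^ lam * ((lam + 1) * K - δ) = 0) ∧
    (∃! y : ℝ, y ∈ Set.Ioi δ ∧ y * Real.log (y / δ) - (y - δ) - K = 0) ∧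
    (∃! y : ℝ, y ∈ Set.Ioi δ ∧ y - δ - δ * Real.log (y / δ) - K = 0) := by
  refine ⟨?_, fun h0 h1 => ?_, ?_, ?_⟩
  · unfold PDL
    split_ifs with h0 h1
    · exact existsUnique_PDL_zero hδ hK
    · exact existsUnique_PDL_neg_one hδ hK
    · exact existsUnique_PDL_generic h0 h1 hδ hK
  · refine (existsUnique_congr fun y => and_congr_right fun hy => ?_).mp
      (existsUnique_PDL_generic h0 h1 hδ hK)
    have h1' : lam + 1 ≠ 0 := fun h => h1 (by linarith)
    have hc : lam * (lam + 1) * δ ^ lam ≠ 0 :=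
      mul_ne_zero (mul_ne_zero h0 h1') (Real.rpow_pos_of_pos hδ lam).ne'
    rw [rpow_polynomial_eq_mul_PDL_sub h0 h1 hδ (hδ.trans hy), mul_eq_zero_iff_left hc,
      sub_eq_zero]
  · simpa only [sub_eq_zero] using existsUnique_PDL_zero hδ hK
  · simpa only [sub_eq_zero] using existsUnique_PDL_neg_one hδ hK
end
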